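/- Let S, T, U be subsets of ℕ such that ∑_{k ∈ U} 2^k = ∑_{k ∈ S} 2^k + ∑_{k ∈ T} 2^k as 2-adically convergent sums in the ring ℤ₂ of 2-adic integers. Then F_S · F_T = F_U in the formal power series ring 𝔽₂[[X]]. (This is the multiplication law making the set of twistings of mod-2 Morava K-theory, identified with grouplike power series in K(n)^0 K(ℤ, n+1) = 𝔽₂[[y]], into a group isomorphic to ℤ₂ as in Theorem 3.3.) -/

import Mathlib

noncomputable section

/-- `B n` is the set of binary digit positions of `n`, i.e. the unique finite set of
non-negative integers with `n = ∑_{k ∈ B n} 2^k`. -/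
def B (n : ℕ) : Finset ℕ := (Finset.range (n + 1)).filter fun k => n.testBit k

open Classical in
/-- `F S ∈ 𝔽₂[[X]]` has coefficient of `X^n` equal to `1` if `B(n) ⊆ S` and `0` otherwise;
for finite `S` one has `F S = ∏_{k ∈ S} (1 + X^{2^k})`. -/
def F (S : Set ℕ) : PowerSeries (ZMod 2) :=
  PowerSeries.mk fun n => if (↑(B n) : Set ℕ) ⊆ S then 1 else 0

theorem mem_B {n k : ℕ} : k ∈ B n ↔ n.testBit k = true := by
  simp only [B, Finset.mem_filter, Finset.mem_range, and_iff_right_iff_imp]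
  intro hk
  have := Nat.ge_two_pow_of_testBit hk
  have := Nat.lt_two_pow_self (n := k)
  omega

open Classical in
/-- Lucas' theorem modulo `2`, in terms of binary digits. -/
theorem choose_cast_zmod_two (m n : ℕ) :
    (m.choose n : ZMod 2) =
      if ∀ k, n.testBit k = true → m.testBit k = true then 1 else 0 := by
  induction n using Nat.strong_induction_on generalizing m with
  | _ n ih =>
    rcases Nat.eq_zero_or_pos n with rfl | hn
    · simp
    have hlucas : (m.choose n : ZMod 2) =
        ((m % 2).choose (n % 2) : ZMod 2) * ((m / 2).choose (n / 2) : ZMod 2) := by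
      have := (ZMod.natCast_eq_natCast_iff _ _ 2).2
        (Choose.choose_modEq_choose_mod_mul_choose_div_nat (p := 2) (n := m) (k := n))
      simpa using this
    have hbits : (∀ k, n.testBit k = true → m.testBit k = true) ↔
        (n % 2 = 1 → m % 2 = 1) ∧
          ∀ k, (n / 2).testBit k = true → (m / 2).testBit k = true := by
      constructor
      · intro h
        refine ⟨by simpa [Nat.testBit_zero] using h 0, fun k => ?_⟩
        simpa [Nat.testBit_succ] using h (k + 1)
      · rintro ⟨h0, h⟩ (_ | k)
        · simpa [Nat.testBit_zero] using h0
        · simpa [Nat.testBit_succ] using h k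
    rw [hlucas, ih (n / 2) (by omega), if_congr hbits rfl rfl]
    rcases Nat.mod_two_eq_zero_or_one m with h1 | h1 <;>
      rcases Nat.mod_two_eq_zero_or_one n with h2 | h2 <;> simp [h1, h2]

/-- The natural number whose binary digits are the elements of `S` below `N`. -/
def truncation (S : Set ℕ) (N : ℕ) : ℕ :=
  ∑ k ∈ Finset.range N, S.indicator (fun k => 2 ^ k) k

theorem truncation_lt (S : Set ℕ) (N : ℕ) : truncation S N < 2 ^ N := by
  induction N with
  | zero => simp [truncation]
  | succ N ih =>
    have : S.indicator (fun k => 2 ^ k) N ≤ 2 ^ N := Set.indicator_le_self _ _ _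
    rw [truncation, Finset.sum_range_succ, pow_succ]
    rw [truncation] at ih
    omega

theorem testBit_truncation (S : Set ℕ) {N k : ℕ} (hk : k < N) :
    (truncation S N).testBit k = true ↔ k ∈ S := by
  induction N with
  | zero => omega
  | succ N ih =>
    have hsucc : truncation S (N + 1) = S.indicator (fun k => 2 ^ k) N + truncation S N := by
      rw [truncation, Finset.sum_range_succ, add_comm, truncation]
    rw [hsucc]
    rcases Nat.lt_succ_iff_lt_or_eq.1 hk with hlt | rfl
    · rw [← ih hlt]
      by_cases hN : N ∈ S
      · rw [Set.indicator_of_mem hN, Nat.testBit_two_pow_add_gt hlt]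
      · rw [Set.indicator_of_notMem hN, zero_add]
    · by_cases hN : k ∈ S
      · simp [Nat.testBit_two_pow_add_eq, Nat.testBit_lt_two_pow (truncation_lt S k), hN]
      · simp [Nat.testBit_lt_two_pow (truncation_lt S k), hN]

theorem summable_indicator_two_pow (S : Set ℕ) :
    Summable (S.indicator fun k : ℕ => (2 : ℤ_[2]) ^ k) := by
  refine Summable.indicator ?_ S
  refine Summable.of_norm ?_
  have h2 : ‖(2 : ℤ_[2])‖ = 2⁻¹ := by simpa using PadicInt.norm_p (p := 2)
  simp only [norm_pow, h2]
  exact summable_geometric_of_lt_one (by norm_num) (by norm_num)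

theorem two_pow_dvd_tsum_sub_truncation (S : Set ℕ) (N : ℕ) :
    (2 : ℤ_[2]) ^ N ∣ (∑' k : S, (2 : ℤ_[2]) ^ (k : ℕ)) - truncation S N := by
  have hshift (i : ℕ) : S.indicator (fun k : ℕ => (2 : ℤ_[2]) ^ k) (i + N) =
      2 ^ N * ((· + N) ⁻¹' S).indicator (fun k : ℕ => (2 : ℤ_[2]) ^ k) i := by
    by_cases hi : i + N ∈ S
    · rw [Set.indicator_of_mem hi, Set.indicator_of_mem (by exact hi), pow_add, mul_comm]
    · rw [Set.indicator_of_notMem hi, Set.indicator_of_notMem (by exact hi), mul_zero]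
  have hcast : (truncation S N : ℤ_[2]) =
      ∑ k ∈ Finset.range N, S.indicator (fun k : ℕ => (2 : ℤ_[2]) ^ k) k := by
    rw [truncation, Nat.cast_sum]
    refine Finset.sum_congr rfl fun k _ => ?_
    by_cases hk : k ∈ S <;> simp [hk]
  rw [tsum_subtype S fun k : ℕ => (2 : ℤ_[2]) ^ k,
    ← (summable_indicator_two_pow S).sum_add_tsum_nat_add N, hcast, add_sub_cancel_left]
  simp only [hshift]
  rw [(summable_indicator_two_pow _).tsum_mul_left]
  exact dvd_mul_right _ _

theorem choose_cast_zmod_two_congr {a b n N : ℕ} (hab : a ≡ b [MOD 2 ^ N]) (hn : n < 2 ^ N) :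
    (a.choose n : ZMod 2) = b.choose n := by
  classical
  rw [choose_cast_zmod_two, choose_cast_zmod_two]
  refine if_congr (forall_congr' fun k => imp_congr_right fun hk => ?_) rfl rfl
  have hkN : k < N :=
    (Nat.pow_lt_pow_iff_right one_lt_two).1 ((Nat.ge_two_pow_of_testBit hk).trans_lt hn)
  have := congrArg (fun x => x.testBit k) hab
  simpa [Nat.testBit_mod_two_pow, hkN] using congrArg (· = true) this

theorem coeff_F_eq_choose (S : Set ℕ) {n N : ℕ} (hn : n < 2 ^ N) :
    PowerSeries.coeff n (F S) = ((truncation S N).choose n : ZMod 2) := by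
  classical
  rw [F, PowerSeries.coeff_mk, choose_cast_zmod_two]
  refine if_congr (forall_congr' fun k => ?_) rfl rfl
  rw [Finset.mem_coe, mem_B]
  refine imp_congr_right fun hk => (testBit_truncation S ?_).symm
  exact (Nat.pow_lt_pow_iff_right one_lt_two).1 ((Nat.ge_two_pow_of_testBit hk).trans_lt hn)

/-- If `∑_{k ∈ U} 2^k = ∑_{k ∈ S} 2^k + ∑_{k ∈ T} 2^k` in `ℤ₂`, then `F_S · F_T = F_U`
in `𝔽₂[[X]]`. -/
theorem F_mul (S T U : Set ℕ)
    (h : (∑' k : U, (2 : ℤ_[2]) ^ (k : ℕ)) =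
      (∑' k : S, (2 : ℤ_[2]) ^ (k : ℕ)) + ∑' k : T, (2 : ℤ_[2]) ^ (k : ℕ)) :
    F S * F T = F U := by
  ext n
  have hn : n < 2 ^ n := Nat.lt_two_pow_self
  have hmod : truncation S n + truncation T n ≡ truncation U n [MOD 2 ^ n] := by
    refine (Nat.modEq_iff_dvd).2 ?_
    have hdvd := (dvd_add (two_pow_dvd_tsum_sub_truncation S n)
      (two_pow_dvd_tsum_sub_truncation T n)).sub (two_pow_dvd_tsum_sub_truncation U n)
    have := (PadicInt.pow_p_dvd_int_iff (p := 2) n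
      ((truncation U n : ℤ) - (truncation S n + truncation T n : ℕ))).1 (by
        convert hdvd using 1
        · norm_num
        · rw [h]
          push_cast
          ring)
    exact_mod_cast this
  rw [coeff_F_eq_choose U hn, ← choose_cast_zmod_two_congr hmod hn, Nat.add_choose_eq,
    PowerSeries.coeff_mul, Nat.cast_sum]
  refine Finset.sum_congr rfl fun p hp => ?_
  have hp' := Finset.HasAntidiagonal.mem_antidiagonal.1 hp
  rw [coeff_F_eq_choose S (N := n) (by omega), coeff_F_eq_choose T (N := n) (by omega),
    Nat.cast_mul]
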